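/- For every integer u ≥ 1 there exists a positive integer c such that 𝒟̄^u(a₁·p₂^u) = c·a_{u+1} in P. -/

import Mathlib

/- We model the polynomial ring `P = ℚ[p₂, p₃, …, a₁, a₂, …]` as
`MvPolynomial (ℕ ⊕ ℕ) ℚ`, where `Sum.inl u` represents the variable `p_{u+2}`
(`u ≥ 0`) and `Sum.inr w` represents the variable `a_{w+1}` (`w ≥ 0`). -/

open MvPolynomial

noncomputable section

/-- A bound exceeding all (shifted) variable indices occurring in `p`. -/
def NP (p : MvPolynomial (ℕ ⊕ ℕ) ℚ) : ℕ := (p.vars.image (Sum.elim id id)).sup id + 1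

/-- The operator
`𝒟̄ = (1/2)·∑_{m,n≥2} binom(m+n, n) p_{m+n−1} ∂_{p_m} ∂_{p_n}
      + ∑_{m≥1, n≥2} binom(m+n−1, n) a_{m+n−1} ∂_{a_m} ∂_{p_n}`.
In our indexing, with `u = m−2, v = n−2` in the first sum (so `p_{m+n−1}` is
`Sum.inl (u+v+1)`) and `w = m−1, v = n−2` in the second (so `a_{m+n−1}` is
`Sum.inr (w+v+1)`); the sums are cut off beyond the variables occurring in the
argument, which loses no nonzero terms. -/
def Dbar (p : MvPolynomial (ℕ ⊕ ℕ) ℚ) : MvPolynomial (ℕ ⊕ ℕ) ℚ :=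
  (1/2 : ℚ) •
    (∑ u ∈ Finset.range (NP p), ∑ v ∈ Finset.range (NP p),
      (((u + v + 4).choose (v + 2) : ℚ)) •
        (X (Sum.inl (u + v + 1)) * pderiv (Sum.inl u) (pderiv (Sum.inl v) p))) +
  ∑ w ∈ Finset.range (NP p), ∑ v ∈ Finset.range (NP p),
    (((w + v + 2).choose (v + 2) : ℚ)) •
      (X (Sum.inr (w + v + 1)) * pderiv (Sum.inr w) (pderiv (Sum.inl v) p))

open Finset in
/-- Half of a symmetric double sum lies in a submonoid as soon as its terms and half of its
diagonal terms do. -/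
lemma half_smul_sum_mem {M : Type*} [AddCommMonoid M] [Module ℚ M] (S : AddSubmonoid M)
    (F : ℕ → ℕ → M) (symm : ∀ u v, F u v = F v u) (mem : ∀ u v, F u v ∈ S)
    (diag : ∀ u, (1 / 2 : ℚ) • F u u ∈ S) (N : ℕ) :
    (1 / 2 : ℚ) • ∑ u ∈ range N, ∑ v ∈ range N, F u v ∈ S := by
  induction N with
  | zero => simp
  | succ N ih =>
    have key : (1 / 2 : ℚ) • ∑ u ∈ range (N + 1), ∑ v ∈ range (N + 1), F u v =
        (1 / 2 : ℚ) • (∑ u ∈ range N, ∑ v ∈ range N, F u v) + ∑ u ∈ range N, F u N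
          + (1 / 2 : ℚ) • F N N := by
      simp only [sum_range_succ, sum_add_distrib, symm N]
      module
    rw [key]
    exact S.add_mem (S.add_mem ih (S.sum_mem fun u _ => mem u N)) (diag N)

lemma MvPolynomial.pderiv_pderiv_comm {σ R : Type*} [CommSemiring R] (i j : σ)
    (p : MvPolynomial σ R) : pderiv i (pderiv j p) = pderiv j (pderiv i p) := by
  classical
  rcases eq_or_ne i j with rfl | h
  · rfl
  · ext m
    simp only [coeff_pderiv, Finsupp.add_apply, Finsupp.single_eq_of_ne h,
      Finsupp.single_eq_of_ne h.symm, add_zero, add_right_comm m (Finsupp.single j 1)]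
    ring

/-- The polynomials over `ℚ` whose coefficients are natural numbers. -/
def natCoeffs (σ : Type*) : Subsemiring (MvPolynomial σ ℚ) :=
  (MvPolynomial.map (Nat.castRingHom ℚ)).rangeS

section natCoeffs

variable {σ : Type*}

lemma X_mem_natCoeffs (i : σ) : X i ∈ natCoeffs σ := ⟨X i, by simp⟩

lemma pderiv_mem_natCoeffs {p : MvPolynomial σ ℚ} (hp : p ∈ natCoeffs σ) (i : σ) :
    pderiv i p ∈ natCoeffs σ := by
  obtain ⟨q, rfl⟩ := hp
  exact ⟨pderiv i q, pderiv_map.symm⟩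

lemma natCast_smul_mem_natCoeffs {p : MvPolynomial σ ℚ} (hp : p ∈ natCoeffs σ) (n : ℕ) :
    (n : ℚ) • p ∈ natCoeffs σ := by
  rw [Nat.cast_smul_eq_nsmul]
  exact nsmul_mem hp n

lemma exists_coeff_eq_natCast {p : MvPolynomial σ ℚ} (hp : p ∈ natCoeffs σ) (m : σ →₀ ℕ) :
    ∃ n : ℕ, coeff m p = n := by
  obtain ⟨q, rfl⟩ := hp
  exact ⟨coeff m q, by simp [coeff_map]⟩

lemma coeff_nonneg_of_mem_natCoeffs {p : MvPolynomial σ ℚ} (hp : p ∈ natCoeffs σ)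
    (m : σ →₀ ℕ) : 0 ≤ coeff m p := by
  obtain ⟨n, hn⟩ := exists_coeff_eq_natCast hp m
  exact hn ▸ n.cast_nonneg

end natCoeffs

lemma joinTerm_mem_natCoeffs {p : MvPolynomial (ℕ ⊕ ℕ) ℚ} (hp : p ∈ natCoeffs (ℕ ⊕ ℕ))
    (c : ℕ) (i j k : ℕ ⊕ ℕ) :
    (c : ℚ) • (X i * pderiv j (pderiv k p)) ∈ natCoeffs (ℕ ⊕ ℕ) :=
  natCast_smul_mem_natCoeffs (mul_mem (X_mem_natCoeffs i)
    (pderiv_mem_natCoeffs (pderiv_mem_natCoeffs hp k) j)) c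

lemma half_sum_mem_natCoeffs {p : MvPolynomial (ℕ ⊕ ℕ) ℚ} (hp : p ∈ natCoeffs (ℕ ⊕ ℕ))
    (N : ℕ) :
    (1 / 2 : ℚ) • (∑ u ∈ Finset.range N, ∑ v ∈ Finset.range N,
      (((u + v + 4).choose (v + 2) : ℚ)) •
        (X (Sum.inl (u + v + 1)) * pderiv (Sum.inl u) (pderiv (Sum.inl v) p))) ∈
      natCoeffs (ℕ ⊕ ℕ) := by
  refine half_smul_sum_mem (natCoeffs (ℕ ⊕ ℕ)).toAddSubmonoid _ (fun u v => ?_)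
    (fun u v => joinTerm_mem_natCoeffs hp _ _ _ _) (fun u => ?_) N
  · rw [pderiv_pderiv_comm, add_comm u v,
      Nat.choose_symm_of_eq_add (show v + u + 4 = (v + 2) + (u + 2) by ring)]
  · obtain ⟨c, hc⟩ := Nat.two_dvd_centralBinom_succ (u + 1)
    have hc' : (u + u + 4).choose (u + 2) = 2 * c := by
      rw [← hc, Nat.centralBinom_eq_two_mul_choose]
      congr 1
      ring
    rw [hc', smul_smul, Nat.cast_mul, ← mul_assoc, Nat.cast_ofNat, one_div_mul_cancel two_ne_zero,
      one_mul]
    exact joinTerm_mem_natCoeffs hp c _ _ _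

lemma Dbar_mem_natCoeffs {p : MvPolynomial (ℕ ⊕ ℕ) ℚ} (hp : p ∈ natCoeffs (ℕ ⊕ ℕ)) :
    Dbar p ∈ natCoeffs (ℕ ⊕ ℕ) :=
  add_mem (half_sum_mem_natCoeffs hp _)
    (sum_mem fun _ _ => sum_mem fun _ _ => joinTerm_mem_natCoeffs hp _ _ _ _)

/-- The three gradings respected by `Dbar`: the total degree, the degree in the `a`-variables,
and the weight giving `p_m` and `a_m` weight `m - 1`. -/
def joinWeight : ℕ ⊕ ℕ → ℤ × ℤ × ℤ :=
  Sum.elim (fun u => (1, 0, (u : ℤ) + 1)) (fun w => (1, 1, (w : ℤ)))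

lemma joinTerm_isWeightedHomogeneous {p : MvPolynomial (ℕ ⊕ ℕ) ℚ} {d e : ℤ × ℤ × ℤ}
    (hp : IsWeightedHomogeneous joinWeight p d) (c : ℚ) {i j k : ℕ ⊕ ℕ}
    (h : joinWeight i + d = e + joinWeight j + joinWeight k) :
    IsWeightedHomogeneous joinWeight (c • (X i * pderiv j (pderiv k p))) e := by
  have hk := hp.pderiv (i := k) (n' := d - joinWeight k) (by abel)
  have hj := hk.pderiv (i := j) (n' := d - joinWeight k - joinWeight j) (by abel)
  have hX := (isWeightedHomogeneous_X ℚ joinWeight i).mul hj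
  rw [show joinWeight i + (d - joinWeight k - joinWeight j) = e by
    rw [← add_sub_assoc, ← add_sub_assoc, h]; abel] at hX
  exact (weightedHomogeneousSubmodule ℚ joinWeight e).smul_mem c hX

lemma Dbar_isWeightedHomogeneous {p : MvPolynomial (ℕ ⊕ ℕ) ℚ} {a b c : ℤ}
    (hp : IsWeightedHomogeneous joinWeight p (a + 1, b, c)) :
    IsWeightedHomogeneous joinWeight (Dbar p) (a, b, c) := by
  refine IsWeightedHomogeneous.add ((weightedHomogeneousSubmodule ℚ joinWeight _).smul_mem _
    (IsWeightedHomogeneous.sum _ _ _ fun u _ => IsWeightedHomogeneous.sum _ _ _ fun v _ =>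
      joinTerm_isWeightedHomogeneous hp _ ?_))
    (IsWeightedHomogeneous.sum _ _ _ fun w _ => IsWeightedHomogeneous.sum _ _ _ fun v _ =>
      joinTerm_isWeightedHomogeneous hp _ ?_) <;>
  · simp only [joinWeight, Sum.elim_inl, Sum.elim_inr, Prod.mk_add_mk, Prod.mk.injEq]
    push_cast
    refine ⟨?_, ?_, ?_⟩ <;> ring

lemma lt_NP_of_mem_vars {p : MvPolynomial (ℕ ⊕ ℕ) ℚ} {i : ℕ ⊕ ℕ} (hi : i ∈ p.vars) :
    Sum.elim id id i < NP p :=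
  Nat.lt_succ_of_le (Finset.le_sup (f := id) (Finset.mem_image_of_mem _ hi))

lemma coeff_le_coeff_sum_of_mem_natCoeffs {σ ι : Type*} {s : Finset ι} {F : ι → MvPolynomial σ ℚ}
    (hF : ∀ i ∈ s, F i ∈ natCoeffs σ) {i : ι} (hi : i ∈ s) (m : σ →₀ ℕ) :
    coeff m (F i) ≤ coeff m (∑ i ∈ s, F i) := by
  rw [coeff_sum]
  exact Finset.single_le_sum (f := fun i => coeff m (F i))
    (fun i hi => coeff_nonneg_of_mem_natCoeffs (hF i hi) m) hi

lemma coeff_joinTerm_pos {p : MvPolynomial (ℕ ⊕ ℕ) ℚ} {c : ℚ} (hc : 0 < c) (i j k : ℕ ⊕ ℕ)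
    (m : (ℕ ⊕ ℕ) →₀ ℕ) (h : 0 < coeff (m + Finsupp.single j 1 + Finsupp.single k 1) p) :
    0 < coeff (Finsupp.single i 1 + m) (c • (X i * pderiv j (pderiv k p))) := by
  rw [coeff_smul, smul_eq_mul, coeff_X_mul, coeff_pderiv, coeff_pderiv]
  positivity

/-- Joining `p₂` to `a_{k+1}` is a term of `Dbar` with nonzero coefficient, and it cannot be
cancelled when all coefficients are nonnegative. -/
lemma coeff_Dbar_ne_zero {p : MvPolynomial (ℕ ⊕ ℕ) ℚ} (hp : p ∈ natCoeffs (ℕ ⊕ ℕ)) {k j : ℕ}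
    (h : coeff (Finsupp.single (Sum.inr k) 1 + Finsupp.single (Sum.inl 0) (j + 1)) p ≠ 0) :
    coeff (Finsupp.single (Sum.inr (k + 1)) 1 + Finsupp.single (Sum.inl 0) j) (Dbar p) ≠ 0 := by
  have hk : k < NP p := lt_NP_of_mem_vars (i := Sum.inr k)
    ((mem_vars_iff_mem_support _).2 ⟨_, mem_support_iff.2 h, by simp⟩)
  have hpos := (coeff_nonneg_of_mem_natCoeffs hp _).lt_of_ne' h
  rw [Finsupp.single_add, ← add_assoc, add_comm (Finsupp.single (Sum.inr k) 1)] at hpos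
  have hterm := coeff_joinTerm_pos (c := ((k + 0 + 2).choose (0 + 2) : ℕ))
    (Nat.cast_pos.2 (Nat.choose_pos (by omega))) (Sum.inr (k + 0 + 1)) _ _ _ hpos
  have hmem : ∀ w v, (((w + v + 2).choose (v + 2) : ℚ)) •
      (X (Sum.inr (w + v + 1)) * pderiv (Sum.inr w) (pderiv (Sum.inl v) p)) ∈
      natCoeffs (ℕ ⊕ ℕ) := fun w v => joinTerm_mem_natCoeffs hp _ _ _ _
  have hinner := hterm.trans_le (coeff_le_coeff_sum_of_mem_natCoeffs (fun v _ => hmem k v)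
    (Finset.mem_range.2 (k.zero_le.trans_lt hk)) _)
  have houter := hinner.trans_le (coeff_le_coeff_sum_of_mem_natCoeffs
    (fun w _ => sum_mem fun v _ => hmem w v) (Finset.mem_range.2 hk) _)
  rw [Dbar, coeff_add]
  exact (add_pos_of_nonneg_of_pos
    (coeff_nonneg_of_mem_natCoeffs (half_sum_mem_natCoeffs hp (NP p)) _) houter).ne'

lemma Dbar_iterate_properties (j : ℕ) {p : MvPolynomial (ℕ ⊕ ℕ) ℚ} {k : ℕ} {b c : ℤ}
    (hp : p ∈ natCoeffs (ℕ ⊕ ℕ)) (hw : IsWeightedHomogeneous joinWeight p ((j : ℤ) + 1, b, c))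
    (h : coeff (Finsupp.single (Sum.inr k) 1 + Finsupp.single (Sum.inl 0) j) p ≠ 0) :
    Dbar^[j] p ∈ natCoeffs (ℕ ⊕ ℕ) ∧ IsWeightedHomogeneous joinWeight (Dbar^[j] p) (1, b, c) ∧
      coeff (Finsupp.single (Sum.inr (k + j)) 1) (Dbar^[j] p) ≠ 0 := by
  induction j generalizing p k with
  | zero => exact ⟨hp, by simpa using hw, by simpa using h⟩
  | succ j ih =>
    have := ih (Dbar_mem_natCoeffs hp) (Dbar_isWeightedHomogeneous (by exact_mod_cast hw))
      (coeff_Dbar_ne_zero hp h)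
    rwa [add_right_comm, add_assoc] at this

lemma weight_joinWeight_fst (m : (ℕ ⊕ ℕ) →₀ ℕ) :
    (Finsupp.weight joinWeight m).1 = (m.degree : ℤ) := by
  rw [Finsupp.weight_apply, Finsupp.sum, Prod.fst_sum, Finsupp.degree_apply, Nat.cast_sum]
  refine Finset.sum_congr rfl fun i _ => ?_
  rcases i with i | i <;> simp [joinWeight]

lemma eq_single_of_weight_joinWeight {m : (ℕ ⊕ ℕ) →₀ ℕ} {u : ℕ}
    (h : Finsupp.weight joinWeight m = (1, 1, (u : ℤ))) : m = Finsupp.single (Sum.inr u) 1 := by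
  have hdeg : m ∈ {d : (ℕ ⊕ ℕ) →₀ ℕ | d.degree = 1} := by
    have := weight_joinWeight_fst m
    rw [h] at this
    exact Nat.cast_injective (R := ℤ) (by simpa using this.symm)
  rw [← Finsupp.range_single_one] at hdeg
  obtain ⟨i | i, rfl⟩ := hdeg
  · simp [Finsupp.weight_single, joinWeight] at h
  · simp [Finsupp.weight_single, joinWeight] at h
    rw [h]

/-- for every `u ≥ 1` there is a positive integer `c` with
`𝒟̄^u(a₁·p₂^u) = c·a_{u+1}` in `P`.  Here `a₁ = X (Sum.inr 0)`, `p₂ = X (Sum.inl 0)`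
and `a_{u+1} = X (Sum.inr u)`. -/
theorem stmt15 (u : ℕ) (hu : 1 ≤ u) :
    ∃ c : ℕ, 0 < c ∧
      Dbar^[u] (X (Sum.inr 0) * X (Sum.inl 0) ^ u) = (c : ℚ) • X (Sum.inr u) := by
  obtain ⟨hN, hW, hc⟩ := Dbar_iterate_properties u (k := 0) (b := 1) (c := u)
    (p := X (Sum.inr 0) * X (Sum.inl 0) ^ u)
    (mul_mem (X_mem_natCoeffs _) (pow_mem (X_mem_natCoeffs _) u))
    (by
      convert (isWeightedHomogeneous_X ℚ joinWeight (Sum.inr 0)).mul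
        ((isWeightedHomogeneous_X ℚ joinWeight (Sum.inl 0)).pow u) using 1
      simp [joinWeight, add_comm])
    (by simp [coeff_X_mul, coeff_X_pow])
  rw [zero_add] at hc
  obtain ⟨c, hcoeff⟩ := exists_coeff_eq_natCast hN (Finsupp.single (Sum.inr u) 1)
  refine ⟨c, Nat.pos_of_ne_zero fun h => hc (by rw [hcoeff, h, Nat.cast_zero]), ?_⟩
  rw [hW.eq_monomial_of_unique_weight fun m hm => eq_single_of_weight_joinWeight hm, hcoeff,
    X, smul_monomial, smul_eq_mul, mul_one]
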